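/- arXiv:1809.10971 — 5 statements merged into one kernel-verified Lean document; each statement's English description precedes it below -/
import Mathlib

section
/- Let f₁,…,f_k ∈ P and let g₁,…,g_t ∈ P be an extended family with g_i = f_i for all 1 ≤ i ≤ k. Let A = (a_{ij}) be a k×t matrix over P such that g_j = Σ_{i=1}^{k} a_{ij} f_i for all j, and a_{ij} = δ_{ij} (Kronecker delta) for all j ≤ k. Then Syz(f₁,…,f_k) = {A·s : s ∈ Syz(g₁,…,g_t)}, where A·s ∈ Pᵏ denotes matrix–vector multiplication. -/
open MvPolynomial

open Matrix in
theorem sum_mulVec_mul {R m n : Type*} [CommSemiring R] [Fintype m] [Fintype n]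
    {A : Matrix m n R} {f : m → R} {g : n → R} (hA : ∀ j, g j = ∑ i, A i j * f i) (s : n → R) :
    ∑ i, (A *ᵥ s) i * f i = ∑ j, s j * g j := by
  simp only [hA, mulVec, dotProduct, Finset.sum_mul, Finset.mul_sum]
  rw [Finset.sum_comm]
  exact Finset.sum_congr rfl fun j _ => Finset.sum_congr rfl fun i _ => by ring

open Matrix in
theorem mulVec_sum_single_of_submatrix_eq_one {R m n : Type*} [CommSemiring R] [Fintype m]
    [DecidableEq m] [Fintype n] [DecidableEq n] {A : Matrix m n R} {e : m → n}
    (hA : ∀ i j, A i (e j) = if i = j then 1 else 0) (p : m → R) :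
    A *ᵥ (∑ i, Pi.single (e i) (p i)) = p := by
  ext i
  simp [mulVec_sum, hA]

/-- Let `g₁,…,g_t` extend `f₁,…,f_k` (i.e. `g_i = f_i` for `i ≤ k`) and let
`A` be a `k × t` matrix over `P` with `g_j = Σᵢ a_{ij} f_i` and `a_{ij} = δ_{ij}` for
`j ≤ k`.  Then `Syz(f₁,…,f_k) = {A·s : s ∈ Syz(g₁,…,g_t)}`. -/
theorem statement4 {K : Type*} [Field K] {n k t : ℕ} (hkt : k ≤ t)
    (f : Fin k → MvPolynomial (Fin n) K) (g : Fin t → MvPolynomial (Fin n) K)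
    (hgf : ∀ i : Fin k, g (Fin.castLE hkt i) = f i)
    (A : Matrix (Fin k) (Fin t) (MvPolynomial (Fin n) K))
    (hA : ∀ j : Fin t, g j = ∑ i, A i j * f i)
    (hId : ∀ i j : Fin k, A i (Fin.castLE hkt j) = if i = j then 1 else 0) :
    {p : Fin k → MvPolynomial (Fin n) K | ∑ i, p i * f i = 0} =
      (fun s => A.mulVec s) '' {s : Fin t → MvPolynomial (Fin n) K | ∑ j, s j * g j = 0} := by
  ext p
  simp only [Set.mem_ofPred_eq, Set.mem_image]
  constructor
  · intro hp
    have hs := mulVec_sum_single_of_submatrix_eq_one hId p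
    exact ⟨_, by rw [← sum_mulVec_mul hA, hs, hp], hs⟩
  · rintro ⟨s, hs, rfl⟩
    rw [sum_mulVec_mul hA, hs]
end

section
/- Let H = (h₁,…,h_t) be a Pommaret basis of an ideal I ⊆ P w.r.t. ≺, enumerated so that whenever x_k is a Pommaret non-multiplicative variable of lm(h_i) and lm(h_j) Pommaret-divides x_k·lm(h_i), then i < j. Suppose that for every i and every Pommaret non-multiplicative variable x_k of lm(h_i) one has the involutive standard representation x_k h_i = Σ_{j=1}^{t} P_j^{(i,k)} h_j with each nonzero P_j^{(i,k)} a polynomial only in the Pommaret multiplicative variables of lm(h_j), and set S_{i,k} = x_k e_i − Σ_j P_j^{(i,k)} e_j ∈ Pᵗ. Then H_syz = {S_{i,k}} is a Pommaret basis of Syz(h₁,…,h_t) w.r.t. the Schreyer order ≺_s: for every nonzero U ∈ Syz(h₁,…,h_t) there exists S_{i,k} ∈ H_syz such that lm_s(S_{i,k}) = x_k e_i, lm_s(U) = x^β e_i, and x_k Pommaret-divides x^β. -/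
open MvPolynomial Finsupp

/-- Monomials in `n` variables, identified with their exponent vectors. -/
abbrev Mon (n : ℕ) := Fin n →₀ ℕ

/-- Total degree of a monomial. -/
def mdeg {n : ℕ} (u : Mon n) : ℕ := u.sum fun _ e => e

/-- The strict degree reverse lexicographic order with `xₙ ≺ ⋯ ≺ x₁`
(the variable `xᵢ` of the paper corresponds to the index `i - 1 : Fin n`). -/
def drl {n : ℕ} (u v : Mon n) : Prop :=
  mdeg u < mdeg v ∨
    (mdeg u = mdeg v ∧ ∃ i : Fin n, v i < u i ∧ ∀ j : Fin n, i < j → u j = v j)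

/-- The reflexive closure of `drl` (`⪯` for degrevlex). -/
def drle {n : ℕ} (u v : Mon n) : Prop := drl u v ∨ u = v

/-- `m` is the degrevlex-leading monomial of `f`. -/
def IsLM {K : Type*} [Field K] {n : ℕ} (f : MvPolynomial (Fin n) K) (m : Mon n) : Prop :=
  m ∈ f.support ∧ ∀ m' ∈ f.support, m' = m ∨ drl m' m

/-- The degrevlex-leading monomial of `f` (junk value `0` for `f = 0`). -/
noncomputable def lm {K : Type*} [Field K] {n : ℕ} (f : MvPolynomial (Fin n) K) : Mon n := by
  classical exact if h : ∃ m, IsLM f m then h.choose else 0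

/-- `xᵢ` is Pommaret-multiplicative for the monomial `u`, i.e. no variable strictly
larger in index (hence strictly smaller in the order `xₙ ≺ ⋯ ≺ x₁`) occurs in `u`
beyond `xᵢ`; for `u = 1` every variable is multiplicative. -/
def PMult {n : ℕ} (u : Mon n) (i : Fin n) : Prop := ∀ j : Fin n, i < j → u j = 0

/-- `u` Pommaret-divides `w`: `w = u · m` for a monomial `m` involving only
Pommaret-multiplicative variables of `u`. -/
def PDiv {n : ℕ} (u w : Mon n) : Prop :=
  ∃ m : Mon n, w = u + m ∧ ∀ i : Fin n, m i ≠ 0 → PMult u i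

/-- The strict Schreyer order on module monomials `x^α eᵢ` of `P^t` induced by the
tuple `h`: `(α, i) ≺ₛ (β, j)` iff `lm(x^α hᵢ) ≺ lm(x^β hⱼ)` or they are equal and
`j < i`. -/
def SLT {K : Type*} [Field K] {n t : ℕ} (h : Fin t → MvPolynomial (Fin n) K)
    (a b : Mon n × Fin t) : Prop :=
  drl (lm (monomial a.1 (1 : K) * h a.2)) (lm (monomial b.1 (1 : K) * h b.2)) ∨
    (lm (monomial a.1 (1 : K) * h a.2) = lm (monomial b.1 (1 : K) * h b.2) ∧ b.2 < a.2)

/-- `mm` is the `≺ₛ`-leading module monomial of `U ∈ P^t`. -/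
def IsLMs {K : Type*} [Field K] {n t : ℕ} (h : Fin t → MvPolynomial (Fin n) K)
    (U : Fin t → MvPolynomial (Fin n) K) (mm : Mon n × Fin t) : Prop :=
  mm.1 ∈ (U mm.2).support ∧
    ∀ i : Fin t, ∀ m ∈ (U i).support, (m, i) = mm ∨ SLT h (m, i) mm

theorem mdeg_add {n : ℕ} (u v : Mon n) : mdeg (u + v) = mdeg u + mdeg v :=
  Finsupp.sum_add_index' (fun _ => rfl) (fun _ _ _ => rfl)

theorem drl_irrefl {n : ℕ} (u : Mon n) : ¬ drl u u := by
  rintro (h | ⟨-, i, hi, -⟩)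
  · exact lt_irrefl _ h
  · exact lt_irrefl _ hi

theorem drl_trans {n : ℕ} {u v w : Mon n} (huv : drl u v) (hvw : drl v w) : drl u w := by
  rcases huv with h₁ | ⟨e₁, i, hi, hi'⟩ <;> rcases hvw with h₂ | ⟨e₂, j, hj, hj'⟩
  · exact Or.inl (h₁.trans h₂)
  · exact Or.inl (e₂ ▸ h₁)
  · exact Or.inl (e₁ ▸ h₂)
  · refine Or.inr ⟨e₁.trans e₂, ?_⟩
    rcases lt_trichotomy i j with hij | rfl | hij
    · exact ⟨j, by rw [hi' j hij]; exact hj,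
        fun l hl => (hi' l (hij.trans hl)).trans (hj' l hl)⟩
    · exact ⟨i, hj.trans hi, fun l hl => (hi' l hl).trans (hj' l hl)⟩
    · exact ⟨i, by rw [← hj' i hij]; exact hi,
        fun l hl => (hi' l hl).trans (hj' l (hij.trans hl))⟩

theorem drl_trichotomy {n : ℕ} (u v : Mon n) : u = v ∨ drl u v ∨ drl v u := by
  by_cases huv : u = v
  · exact Or.inl huv
  right
  rcases lt_trichotomy (mdeg u) (mdeg v) with hd | hd | hd
  · exact Or.inl (Or.inl hd)
  · have hne : (Finset.univ.filter fun i => u i ≠ v i).Nonempty := by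
      obtain ⟨i, hi⟩ := DFunLike.ne_iff.1 huv
      exact ⟨i, by simpa using hi⟩
    have hmax := Finset.max'_mem _ hne
    set i := Finset.max' _ hne with hi_def
    have hgt : ∀ j, i < j → u j = v j := by
      intro j hj
      by_contra hc
      exact absurd (Finset.le_max' _ j (by simpa using hc)) (not_le.2 hj)
    have hi : u i ≠ v i := by simpa using hmax
    rcases lt_or_gt_of_ne hi with hlt | hlt
    · exact Or.inr (Or.inr ⟨hd.symm, i, hlt, fun j hj => (hgt j hj).symm⟩)
    · exact Or.inl (Or.inr ⟨hd, i, hlt, hgt⟩)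
  · exact Or.inr (Or.inl hd)

theorem drl_add_left {n : ℕ} {u v : Mon n} (a : Mon n) (h : drl u v) : drl (a + u) (a + v) := by
  rcases h with h | ⟨e, i, hi, hi'⟩
  · left
    rw [mdeg_add, mdeg_add]
    omega
  · refine Or.inr ⟨by rw [mdeg_add, mdeg_add, e], i, ?_, fun j hj => ?_⟩
    · simpa using hi
    · simpa using hi' j hj

theorem Finset.exists_greatest_of_trichotomy {ι : Type*} {r : ι → ι → Prop}
    (htrans : ∀ {a b c}, r a b → r b c → r a c) (htri : ∀ a b, a = b ∨ r a b ∨ r b a)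
    {s : Finset ι} (hs : s.Nonempty) : ∃ a ∈ s, ∀ b ∈ s, b = a ∨ r b a := by
  induction hs using Finset.Nonempty.cons_induction with
  | singleton a => exact ⟨a, by simp, by simp⟩
  | cons a s ha hs ih =>
    obtain ⟨c, hc, hmax⟩ := ih
    rcases htri a c with rfl | h | h
    · exact absurd hc ha
    · refine ⟨c, Finset.mem_cons_of_mem hc, fun b hb => ?_⟩
      rcases Finset.mem_cons.1 hb with rfl | hb
      · exact Or.inr h
      · exact hmax b hb
    · refine ⟨a, Finset.mem_cons_self a s, fun b hb => ?_⟩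
      rcases Finset.mem_cons.1 hb with rfl | hb
      · exact Or.inl rfl
      · rcases hmax b hb with rfl | hb
        · exact Or.inr h
        · exact Or.inr (htrans hb h)

section LeadingMonomial

variable {K : Type*} [Field K] {n t : ℕ}

theorem isLM_unique {f : MvPolynomial (Fin n) K} {u v : Mon n} (hu : IsLM f u) (hv : IsLM f v) :
    u = v := by
  rcases hv.2 u hu.1 with h | h
  · exact h
  rcases hu.2 v hv.1 with h' | h'
  · exact h'.symm
  · exact absurd (drl_trans h h') (drl_irrefl u)

theorem isLM_lm {f : MvPolynomial (Fin n) K} (hf : f ≠ 0) : IsLM f (lm f) := by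
  have h : ∃ m, IsLM f m := Finset.exists_greatest_of_trichotomy (r := drl) drl_trans drl_trichotomy
    (MvPolynomial.support_nonempty.2 hf)
  rw [lm, dif_pos h]
  exact h.choose_spec

theorem lm_monomial_mul (a : Mon n) {f : MvPolynomial (Fin n) K} (hf : f ≠ 0) :
    lm (monomial a (1 : K) * f) = a + lm f := by
  have hlm : IsLM (monomial a (1 : K) * f) (a + lm f) := by
    refine ⟨?_, fun m hm => ?_⟩
    · rw [MvPolynomial.mem_support_iff, MvPolynomial.coeff_monomial_mul, one_mul]
      exact MvPolynomial.mem_support_iff.1 (isLM_lm hf).1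
    · rw [MvPolynomial.mem_support_iff, MvPolynomial.coeff_monomial_mul'] at hm
      split_ifs at hm with ham
      · rw [one_mul, ← MvPolynomial.mem_support_iff] at hm
        rw [← add_tsub_cancel_of_le ham]
        exact ((isLM_lm hf).2 _ hm).imp (fun h => by rw [h]) (drl_add_left a)
      · exact absurd rfl hm
  refine isLM_unique (isLM_lm fun h0 => ?_) hlm
  rw [h0] at hlm
  simpa using hlm.1

theorem slt_iff {h : Fin t → MvPolynomial (Fin n) K} (hne : ∀ i, h i ≠ 0) (a b : Mon n × Fin t) :
    SLT h a b ↔ drl (a.1 + lm (h a.2)) (b.1 + lm (h b.2)) ∨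
      (a.1 + lm (h a.2) = b.1 + lm (h b.2) ∧ b.2 < a.2) := by
  rw [SLT, lm_monomial_mul _ (hne _), lm_monomial_mul _ (hne _)]

theorem slt_trans {h : Fin t → MvPolynomial (Fin n) K} {a b c : Mon n × Fin t}
    (hab : SLT h a b) (hbc : SLT h b c) : SLT h a c := by
  rcases hab with hab | ⟨e, hab⟩ <;> rcases hbc with hbc | ⟨e', hbc⟩
  · exact Or.inl (drl_trans hab hbc)
  · exact Or.inl (e' ▸ hab)
  · exact Or.inl (e ▸ hbc)
  · exact Or.inr ⟨e.trans e', hbc.trans hab⟩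

theorem slt_trichotomy {h : Fin t → MvPolynomial (Fin n) K} (hne : ∀ i, h i ≠ 0)
    (a b : Mon n × Fin t) : a = b ∨ SLT h a b ∨ SLT h b a := by
  rw [slt_iff hne, slt_iff hne]
  rcases drl_trichotomy (a.1 + lm (h a.2)) (b.1 + lm (h b.2)) with e | hlt | hlt
  · rcases lt_trichotomy a.2 b.2 with hlt | e' | hlt
    · exact Or.inr (Or.inr (Or.inr ⟨e.symm, hlt⟩))
    · rw [e'] at e
      exact Or.inl (Prod.ext (add_right_cancel e) e')
    · exact Or.inr (Or.inl (Or.inr ⟨e, hlt⟩))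
  · exact Or.inr (Or.inl (Or.inl hlt))
  · exact Or.inr (Or.inr (Or.inl hlt))

theorem exists_isLMs {h : Fin t → MvPolynomial (Fin n) K} (hne : ∀ i, h i ≠ 0)
    {U : Fin t → MvPolynomial (Fin n) K} (hU : U ≠ 0) : ∃ mm, IsLMs h U mm := by
  classical
  let s : Finset (Mon n × Fin t) :=
    Finset.univ.biUnion fun j => (U j).support.image fun m => (m, j)
  have hs : ∀ m j, (m, j) ∈ s ↔ m ∈ (U j).support := by
    intro m j
    simp [s]
  have hsne : s.Nonempty := by
    obtain ⟨j, hj⟩ := Function.ne_iff.1 hU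
    obtain ⟨m, hm⟩ := MvPolynomial.support_nonempty.2 hj
    exact ⟨(m, j), (hs m j).2 hm⟩
  obtain ⟨a, ha, hmax⟩ :=
    Finset.exists_greatest_of_trichotomy (r := SLT h) slt_trans (slt_trichotomy hne) hsne
  exact ⟨a, (hs _ _).1 ha, fun j m hm => hmax _ ((hs m j).2 hm)⟩

/-- If no other component reaches the weight of the Schreyer leading monomial of `q`, the
corresponding coefficient of `∑ j, q j * h j` does not cancel. -/
theorem coeff_sum_mul_ne_zero {h : Fin t → MvPolynomial (Fin n) K} (hne : ∀ i, h i ≠ 0)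
    {q : Fin t → MvPolynomial (Fin n) K} {m : Mon n} {j : Fin t} (hq : IsLMs h q (m, j))
    (huniq : ∀ j', ∀ m' ∈ (q j').support, m' + lm (h j') = m + lm (h j) → j' = j) :
    coeff (m + lm (h j)) (∑ i, q i * h i) ≠ 0 := by
  have key : ∀ i x y, x + y = m + lm (h j) → coeff x (q i) * coeff y (h i) ≠ 0 →
      i = j ∧ x = m := by
    intro i x y hxy hc
    have hx : x ∈ (q i).support := MvPolynomial.mem_support_iff.2 (left_ne_zero_of_mul hc)
    have hy : y ∈ (h i).support := MvPolynomial.mem_support_iff.2 (right_ne_zero_of_mul hc)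
    rcases hq.2 i x hx with e | hlt
    · exact ⟨congrArg Prod.snd e, congrArg Prod.fst e⟩
    rw [slt_iff hne] at hlt
    rcases hlt with hlt | ⟨e, hlt⟩
    · exfalso
      rcases (isLM_lm (hne i)).2 y hy with rfl | hy
      · exact drl_irrefl _ (hxy ▸ hlt)
      · have := drl_trans (drl_add_left x hy) hlt
        rw [hxy] at this
        exact drl_irrefl _ this
    · exact absurd (huniq i x hx e) hlt.ne'
  rw [MvPolynomial.coeff_sum, Finset.sum_eq_single j, MvPolynomial.coeff_mul,
    Finset.sum_eq_single (m, lm (h j))]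
  · exact mul_ne_zero (MvPolynomial.mem_support_iff.1 hq.1)
      (MvPolynomial.mem_support_iff.1 (isLM_lm (hne j)).1)
  · rintro ⟨x, y⟩ hxy hne'
    by_contra hc
    rw [Finset.HasAntidiagonal.mem_antidiagonal] at hxy
    obtain ⟨-, rfl⟩ := key j x y hxy hc
    exact hne' (Prod.ext rfl (add_left_cancel hxy))
  · intro hc
    exact absurd (by rw [Finset.HasAntidiagonal.mem_antidiagonal]) hc
  · intro i _ hij
    rw [MvPolynomial.coeff_mul]
    refine Finset.sum_eq_zero ?_
    rintro ⟨x, y⟩ hxy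
    by_contra hc
    exact hij (key i x y (Finset.HasAntidiagonal.mem_antidiagonal.1 hxy) hc).1
  · intro hc
    exact absurd (Finset.mem_univ j) hc

end LeadingMonomial

theorem pDiv_total_of_pDiv {n : ℕ} {u v w : Mon n} (hu : PDiv u w) (hv : PDiv v w) :
    PDiv u v ∨ PDiv v u := by
  have step : ∀ {u v : Mon n} {k : Fin n}, PDiv u w → PDiv v w → ¬ PMult u k → PMult v k →
      PDiv v u := by
    rintro u v k ⟨a, ha, ha'⟩ ⟨b, hb, hb'⟩ huk hvk
    have hak : ∀ l ≤ k, a l = 0 := by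
      intro l hl
      by_contra hc
      exact huk fun j hj => ha' l hc j (hl.trans_lt hj)
    have hw : ∀ l, u l + a l = v l + b l := fun l => by
      rw [← Finsupp.add_apply, ← Finsupp.add_apply, ← ha, ← hb]
    have hle : v ≤ u := by
      intro l
      rcases le_or_gt l k with hl | hl
      · have := hw l
        have := hak l hl
        omega
      · rw [hvk l hl]
        exact Nat.zero_le _
    refine ⟨u - v, (add_tsub_cancel_of_le hle).symm, fun l hl => ?_⟩
    rcases le_or_gt l k with hlk | hlk
    · refine hb' l fun hbl => hl ?_
      have := hw l
      have := hak l hlk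
      rw [Finsupp.tsub_apply]
      omega
    · exact fun j hj => hvk j (hlk.trans hj)
  by_cases hsame : ∀ k, PMult u k ↔ PMult v k
  · obtain ⟨a, ha, ha'⟩ := hu
    obtain ⟨b, hb, hb'⟩ := hv
    have hw : ∀ l, u l + a l = v l + b l := fun l => by
      rw [← Finsupp.add_apply, ← Finsupp.add_apply, ← ha, ← hb]
    have hdiv_v : u ≤ v → PDiv u v := fun hle =>
      ⟨v - u, (add_tsub_cancel_of_le hle).symm, fun l hl => ha' l fun hal => hl (by
        have := hw l
        rw [Finsupp.tsub_apply]
        omega)⟩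
    have hdiv_u : v ≤ u → PDiv v u := fun hle =>
      ⟨u - v, (add_tsub_cancel_of_le hle).symm, fun l hl => hb' l fun hbl => hl (by
        have := hw l
        rw [Finsupp.tsub_apply]
        omega)⟩
    by_contra! hc
    have hnle : ¬ u ≤ v := fun hle => hc.1 (hdiv_v hle)
    have hnle' : ¬ v ≤ u := fun hle => hc.2 (hdiv_u hle)
    rw [Finsupp.le_def] at hnle hnle'
    push Not at hnle hnle'
    obtain ⟨i, hi⟩ := hnle
    obtain ⟨j, hj⟩ := hnle'
    have hvi : PMult v i := hb' i fun hb0 => by have := hw i; omega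
    have huj : PMult u j := ha' j fun ha0 => by have := hw j; omega
    rcases lt_trichotomy i j with hij | rfl | hij
    · have := hvi j hij
      omega
    · omega
    · have := huj i hij
      omega
  · push Not at hsame
    obtain ⟨k, ⟨hk, hk'⟩ | ⟨hk, hk'⟩⟩ := hsame
    · exact Or.inl (step hv hu hk' hk)
    · exact Or.inr (step hu hv hk hk')

section PommaretBasis

variable {K : Type*} [Field K] {n t : ℕ} {h : Fin t → MvPolynomial (Fin n) K}

theorem eq_of_pDiv_of_pDiv (hauto : ∀ i j : Fin t, i ≠ j → ¬ PDiv (lm (h j)) (lm (h i)))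
    {w : Mon n} {i j : Fin t} (hi : PDiv (lm (h i)) w) (hj : PDiv (lm (h j)) w) : i = j := by
  by_contra hij
  rcases pDiv_total_of_pDiv hi hj with hd | hd
  · exact hauto j i (Ne.symm hij) hd
  · exact hauto i j hij hd

theorem pDiv_add_left {n : ℕ} {u m : Mon n} (hm : ∀ l, m l ≠ 0 → PMult u l) : PDiv u (m + u) :=
  ⟨m, add_comm m u, hm⟩

/-- Following involutive divisors of non-multiplicative prolongations strictly increases the
index until the involutive divisor of the monomial is reached. -/
theorem lt_of_nonmult_of_pDiv (hne : ∀ i, h i ≠ 0)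
    {I : Ideal (MvPolynomial (Fin n) K)} (hmem : ∀ i, h i ∈ I)
    (hauto : ∀ i j : Fin t, i ≠ j → ¬ PDiv (lm (h j)) (lm (h i)))
    (hbasis : ∀ f ∈ I, f ≠ 0 → ∃ i, PDiv (lm (h i)) (lm f))
    (horder : ∀ (i : Fin t) (k : Fin n), ¬ PMult (lm (h i)) k →
      ∀ j : Fin t, PDiv (lm (h j)) (Finsupp.single k 1 + lm (h i)) → i < j)
    {i j : Fin t} {m : Mon n} {k : Fin n} (hmk : m k ≠ 0) (hk : ¬ PMult (lm (h j)) k)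
    (hi : PDiv (lm (h i)) (m + lm (h j))) : j < i := by
  induction j using WellFoundedGT.induction generalizing m k with
  | ind j ih =>
    obtain ⟨j', hj'⟩ := hbasis (monomial (Finsupp.single k 1) 1 * h j)
      (I.mul_mem_left _ (hmem j)) (mul_ne_zero (by simp) (hne j))
    rw [lm_monomial_mul _ (hne j)] at hj'
    have hjj' : j < j' := horder j k hk j' hj'
    obtain ⟨r, hr, -⟩ := hj'
    have hle : Finsupp.single k 1 ≤ m := by
      rw [Finsupp.single_le_iff]
      omega
    have hw : m + lm (h j) = (m - Finsupp.single k 1 + r) + lm (h j') := by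
      calc m + lm (h j) = (m - Finsupp.single k 1 + Finsupp.single k 1) + lm (h j) := by
            rw [tsub_add_cancel_of_le hle]
        _ = m - Finsupp.single k 1 + (lm (h j') + r) := by rw [add_assoc, hr]
        _ = _ := by rw [add_comm (lm (h j')) r, add_assoc]
    rw [hw] at hi
    by_cases hm' : ∀ l, (m - Finsupp.single k 1 + r : Mon n) l ≠ 0 → PMult (lm (h j')) l
    · rwa [eq_of_pDiv_of_pDiv hauto hi (pDiv_add_left hm')]
    · push Not at hm'
      obtain ⟨l, hl, hl'⟩ := hm'
      exact hjj'.trans (ih j' hjj' hl hl' hi)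

theorem eq_or_drl_of_coeff_X_mul_ne_zero (hne : ∀ i, h i ≠ 0) {i : Fin t} {k : Fin n}
    {w : Mon n} (hw : coeff w (X k * h i) ≠ 0) :
    w = Finsupp.single k 1 + lm (h i) ∨ drl w (Finsupp.single k 1 + lm (h i)) := by
  have h0 : monomial (Finsupp.single k 1) (1 : K) * h i ≠ 0 := mul_ne_zero (by simp) (hne i)
  have := (isLM_lm h0).2 w (MvPolynomial.mem_support_iff.2 hw)
  rwa [lm_monomial_mul _ (hne i)] at this

/-- In an involutive representation every term lies below the represented prolongation. -/
theorem eq_or_drl_of_involutive_representation (hne : ∀ i, h i ≠ 0)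
    (hauto : ∀ i j : Fin t, i ≠ j → ¬ PDiv (lm (h j)) (lm (h i)))
    {q : Fin t → MvPolynomial (Fin n) K} {i : Fin t} {k : Fin n}
    (hrep : X k * h i = ∑ j, q j * h j)
    (hmult : ∀ j, ∀ m ∈ (q j).support, ∀ l : Fin n, m l ≠ 0 → PMult (lm (h j)) l)
    {j : Fin t} {m : Mon n} (hm : m ∈ (q j).support) :
    m + lm (h j) = Finsupp.single k 1 + lm (h i) ∨
      drl (m + lm (h j)) (Finsupp.single k 1 + lm (h i)) := by
  have hq : q ≠ 0 := by
    rintro rfl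
    simp at hm
  obtain ⟨⟨m₀, j₀⟩, htop⟩ := exists_isLMs hne hq
  have hc := coeff_sum_mul_ne_zero hne htop fun j' m' hm' e =>
    eq_of_pDiv_of_pDiv hauto (e ▸ pDiv_add_left (hmult j' m' hm'))
      (pDiv_add_left (hmult j₀ m₀ htop.1))
  rw [← hrep] at hc
  have hle := eq_or_drl_of_coeff_X_mul_ne_zero hne hc
  rcases htop.2 j m hm with e | hlt
  · obtain ⟨rfl, rfl⟩ := Prod.mk.inj e
    exact hle
  · rw [slt_iff hne] at hlt
    rcases hlt with hlt | ⟨e, -⟩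
    · rcases hle with e | hle
      · exact Or.inr (e ▸ hlt)
      · exact Or.inr (drl_trans hlt hle)
    · rw [show m + lm (h j) = m₀ + lm (h j₀) from e]
      exact hle

theorem isLMs_prolongation_syzygy (hne : ∀ i, h i ≠ 0)
    (hauto : ∀ i j : Fin t, i ≠ j → ¬ PDiv (lm (h j)) (lm (h i)))
    (horder : ∀ (i : Fin t) (k : Fin n), ¬ PMult (lm (h i)) k →
      ∀ j : Fin t, PDiv (lm (h j)) (Finsupp.single k 1 + lm (h i)) → i < j)
    {q : Fin t → MvPolynomial (Fin n) K} {i : Fin t} {k : Fin n} (hk : ¬ PMult (lm (h i)) k)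
    (hrep : X k * h i = ∑ j, q j * h j)
    (hmult : ∀ j, ∀ m ∈ (q j).support, ∀ l : Fin n, m l ≠ 0 → PMult (lm (h j)) l) :
    IsLMs h (fun j => (if j = i then (X k : MvPolynomial (Fin n) K) else 0) - q j)
      (Finsupp.single k 1, i) := by
  classical
  refine ⟨?_, fun j m hm => ?_⟩
  · have h0 : coeff (Finsupp.single k 1) (q i) = 0 := by
      by_contra hc
      exact hk (hmult i _ (MvPolynomial.mem_support_iff.2 hc) k (by simp))
    simp [MvPolynomial.mem_support_iff, h0]
  · by_cases hmq : m ∈ (q j).support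
    · right
      rw [slt_iff hne]
      rcases eq_or_drl_of_involutive_representation hne hauto hrep hmult hmq with e | hlt
      · exact Or.inr ⟨e, horder i k hk j (e ▸ pDiv_add_left (hmult j m hmq))⟩
      · exact Or.inl hlt
    · left
      rw [MvPolynomial.notMem_support_iff] at hmq
      rw [MvPolynomial.mem_support_iff, MvPolynomial.coeff_sub, hmq, sub_zero] at hm
      split_ifs at hm with hji
      · rw [MvPolynomial.coeff_X] at hm
        split_ifs at hm with hkm
        · rw [hkm, hji]
        · exact absurd rfl hm
      · exact absurd (MvPolynomial.coeff_zero m) hm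

theorem exists_nonmult_of_isLMs_syzygy (hne : ∀ i, h i ≠ 0)
    {I : Ideal (MvPolynomial (Fin n) K)} (hmem : ∀ i, h i ∈ I)
    (hauto : ∀ i j : Fin t, i ≠ j → ¬ PDiv (lm (h j)) (lm (h i)))
    (hbasis : ∀ f ∈ I, f ≠ 0 → ∃ i, PDiv (lm (h i)) (lm f))
    (horder : ∀ (i : Fin t) (k : Fin n), ¬ PMult (lm (h i)) k →
      ∀ j : Fin t, PDiv (lm (h j)) (Finsupp.single k 1 + lm (h i)) → i < j)
    {U : Fin t → MvPolynomial (Fin n) K} (hsyz : ∑ j, U j * h j = 0) {β : Mon n} {i : Fin t}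
    (hβ : IsLMs h U (β, i)) : ∃ l, β l ≠ 0 ∧ ¬ PMult (lm (h i)) l := by
  by_contra! hmult
  refine coeff_sum_mul_ne_zero hne hβ (fun j m hm e => ?_) (by rw [hsyz, MvPolynomial.coeff_zero])
  have hdiv : PDiv (lm (h i)) (m + lm (h j)) := e ▸ pDiv_add_left hmult
  by_cases hmj : ∀ l, m l ≠ 0 → PMult (lm (h j)) l
  · exact eq_of_pDiv_of_pDiv hauto (pDiv_add_left hmj) hdiv
  · push Not at hmj
    obtain ⟨l, hl, hl'⟩ := hmj
    have hji := lt_of_nonmult_of_pDiv hne hmem hauto hbasis horder hl hl' hdiv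
    rcases hβ.2 j m hm with e' | hlt
    · exact congrArg Prod.snd e'
    · rw [slt_iff hne] at hlt
      rcases hlt with hlt | ⟨-, hlt⟩
      · exact absurd (e ▸ hlt) (drl_irrefl _)
      · exact absurd hlt hji.asymm

end PommaretBasis

theorem exists_minimal_pDiv_single {n : ℕ} {β : Mon n} {l : Fin n} (hl : β l ≠ 0) :
    ∃ k ≤ l, PDiv (Finsupp.single k 1) β := by
  have hs : (Finset.univ.filter fun k => β k ≠ 0).Nonempty := ⟨l, by simpa using hl⟩
  have hk := Finset.min'_mem _ hs
  have hmin : ∀ j, β j ≠ 0 → Finset.min' _ hs ≤ j := fun j hj =>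
    Finset.min'_le _ j (by simpa using hj)
  set k := Finset.min' _ hs
  have hk0 : β k ≠ 0 := by simpa using hk
  refine ⟨k, hmin l hl, β - Finsupp.single k 1, (add_tsub_cancel_of_le ?_).symm, ?_⟩
  · rw [Finsupp.single_le_iff]
    omega
  · intro i hi j hij
    have hki : k ≤ i := hmin i fun h0 => hi (by rw [Finsupp.tsub_apply, h0, Nat.zero_sub])
    exact Finsupp.single_eq_of_ne (hki.trans_lt hij).ne'

/-- involutive Schreyer theorem for Pommaret bases: the syzygies
`Sᵢ,ₖ = xₖ eᵢ − Σⱼ Pⱼ^{(i,k)} eⱼ` coming from the involutive standard representations of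
the non-multiplicative prolongations `xₖ hᵢ` form a Pommaret basis of `Syz(h₁, …, hₜ)`
with respect to the Schreyer order. -/
theorem statement6 {K : Type*} [Field K] {n t : ℕ}
    (h : Fin t → MvPolynomial (Fin n) K) (hne : ∀ i, h i ≠ 0) (hinj : Function.Injective h)
    (I : Ideal (MvPolynomial (Fin n) K)) (hmem : ∀ i, h i ∈ I)
    (hauto : ∀ i j : Fin t, i ≠ j → ¬ PDiv (lm (h j)) (lm (h i)))
    (hbasis : ∀ f ∈ I, f ≠ 0 → ∃ i, PDiv (lm (h i)) (lm f))
    (horder : ∀ (i : Fin t) (k : Fin n), ¬ PMult (lm (h i)) k →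
      ∀ j : Fin t, PDiv (lm (h j)) (Finsupp.single k 1 + lm (h i)) → i < j)
    (p : Fin t → Fin n → Fin t → MvPolynomial (Fin n) K)
    (hrep : ∀ (i : Fin t) (k : Fin n), ¬ PMult (lm (h i)) k →
      (X k * h i = ∑ j, p i k j * h j) ∧
      ∀ j, p i k j ≠ 0 → ∀ m ∈ (p i k j).support, ∀ l : Fin n, m l ≠ 0 →
        PMult (lm (h j)) l) :
    ∀ U : Fin t → MvPolynomial (Fin n) K, U ≠ 0 → (∑ j, U j * h j = 0) →
      ∃ (i : Fin t) (k : Fin n), ¬ PMult (lm (h i)) k ∧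
        IsLMs h (fun j => (if j = i then (X k : MvPolynomial (Fin n) K) else 0) - p i k j)
          (Finsupp.single k 1, i) ∧
        ∃ β : Mon n, IsLMs h U (β, i) ∧ PDiv (Finsupp.single k 1) β := by
  intro U hU hsyz
  obtain ⟨⟨β, i⟩, hβ⟩ := exists_isLMs hne hU
  obtain ⟨l, hl, hil⟩ := exists_nonmult_of_isLMs_syzygy hne hmem hauto hbasis horder hsyz hβ
  obtain ⟨k, hkl, hdiv⟩ := exists_minimal_pDiv_single hl
  have hk : ¬ PMult (lm (h i)) k := fun hc => hil fun j hj => hc j (hkl.trans_lt hj)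
  obtain ⟨hsum, hmult⟩ := hrep i k hk
  refine ⟨i, k, hk, isLMs_prolongation_syzygy hne hauto horder hk hsum fun j m hm => ?_,
    β, hβ, hdiv⟩
  refine hmult j (fun h0 => ?_) m hm
  rw [h0] at hm
  simp at hm
end

section
/- A nonzero monomial ideal I ⊆ P is quasi stable if and only if I possesses a finite Pommaret basis consisting of monomials. -/
open MvPolynomial Finsupp

theorem PDiv.refl {n : ℕ} (u : Mon n) : PDiv u u := ⟨0, by simp, by simp⟩

theorem PDiv.trans {n : ℕ} {u v w : Mon n} (huv : PDiv u v) (hvw : PDiv v w) : PDiv u w := by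
  obtain ⟨a, rfl, ha⟩ := huv
  obtain ⟨b, rfl, hb⟩ := hvw
  refine ⟨a + b, add_assoc u a b, fun i hi => ?_⟩
  by_cases hai : a i = 0
  · have hbi : b i ≠ 0 := by simpa [hai] using hi
    intro j hj
    have := hb i hbi j hj
    simp only [Finsupp.add_apply] at this
    omega
  · exact ha i hai

theorem PDiv.le {n : ℕ} {u v : Mon n} (h : PDiv u v) : u ≤ v := by
  obtain ⟨a, rfl, -⟩ := h
  exact le_self_add

/-- Removing one power of the last occurring variable yields a Pommaret divisor. -/
theorem pDiv_sub_single {n : ℕ} {u : Mon n} {k : Fin n} (hk : 0 < u k)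
    (hlast : ∀ j, k < j → u j = 0) : PDiv (u - Finsupp.single k 1) u := by
  refine ⟨Finsupp.single k 1, (tsub_add_cancel_of_le (by simpa using Nat.succ_le_of_lt hk)).symm,
    fun i hi j hj => ?_⟩
  obtain rfl : k = i := by
    by_contra h
    exact hi (by simp [h])
  simp [hlast j hj]

/-- The elements of `U` without a proper Pommaret divisor in `U`. -/
def pommaretMinimal {n : ℕ} (U : Set (Mon n)) : Set (Mon n) :=
  {u | u ∈ U ∧ ∀ v ∈ U, PDiv v u → v = u}

theorem exists_pommaretMinimal_pDiv {n : ℕ} {U : Set (Mon n)} {w : Mon n} (hw : w ∈ U) :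
    ∃ u ∈ pommaretMinimal U, PDiv u w := by
  obtain ⟨u, ⟨huU, huw⟩, hmin⟩ :=
    wellFounded_lt.has_min {u : Mon n | u ∈ U ∧ PDiv u w} ⟨w, hw, PDiv.refl w⟩
  refine ⟨u, ⟨huU, fun v hv hvu => ?_⟩, huw⟩
  by_contra hne
  exact hmin v ⟨hv, hvu.trans huw⟩ (lt_of_le_of_ne hvu.le hne)

theorem finite_pommaretMinimal {n : ℕ} {U : Set (Mon n)} (hU : IsUpperSet U)
    (hqs : ∀ m ∈ U, ∀ i j : Fin n, j < i → ∀ s : ℕ, 0 < s → s ≤ m i →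
      ∃ t : ℕ, m - Finsupp.single i s + Finsupp.single j t ∈ U) :
    (pommaretMinimal U).Finite := by
  have hex : ∀ (g : Mon n) (i j : Fin n), ∃ t : ℕ, g ∈ U → j < i → 0 < g i →
      g - Finsupp.single i (g i) + Finsupp.single j t ∈ U := by
    intro g i j
    by_cases h : g ∈ U ∧ j < i ∧ 0 < g i
    · obtain ⟨t, ht⟩ := hqs g h.1 i j h.2.1 (g i) h.2.2 le_rfl
      exact ⟨t, fun _ _ _ => ht⟩
    · exact ⟨0, fun h1 h2 h3 => absurd ⟨h1, h2, h3⟩ h⟩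
  choose t ht using hex
  let b : Mon n → Mon n := fun g => Finsupp.equivFunOnFinite.symm fun j => g j + ∑ i, t g i j
  have hfin : {g | Minimal (· ∈ U) g}.Finite :=
    WellQuasiOrderedLE.finite_of_isAntichain (setOfPred_minimal_antichain (· ∈ U))
  refine (hfin.biUnion fun g _ => Set.finite_Iic (b g)).subset ?_
  rintro u ⟨huU, hu⟩
  obtain ⟨g, hgu, hg⟩ := exists_minimal_le_of_wellFoundedLT (· ∈ U) u huU
  refine Set.mem_biUnion (show g ∈ {g | Minimal (· ∈ U) g} from hg) fun j => ?_
  change u j ≤ g j + ∑ i, t g i j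
  by_cases hu0 : u = 0
  · simp [hu0]
  have hne : u.support.Nonempty := Finsupp.support_nonempty_iff.mpr hu0
  obtain ⟨k, hks, hkmax⟩ : ∃ k ∈ u.support, ∀ j ∈ u.support, j ≤ k :=
    ⟨_, u.support.max'_mem hne, fun j hj => u.support.le_max' j hj⟩
  have hk : 0 < u k := Nat.pos_of_ne_zero (Finsupp.mem_support_iff.mp hks)
  have hlast : ∀ j, k < j → u j = 0 := fun j hj => by
    by_contra h
    exact absurd (hkmax j (Finsupp.mem_support_iff.mpr h)) (not_le.mpr hj)
  have hnot : u - Finsupp.single k 1 ∉ U := fun h => by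
    have := DFunLike.congr_fun (hu _ h (pDiv_sub_single hk hlast)) k
    simp at this
    omega
  have hgk : g k = u k := by
    refine le_antisymm (hgu k) (not_lt.mp fun hlt => hnot (hU (fun l => ?_) hg.1))
    have := hgu l
    by_cases hl : k = l
    · subst hl
      simp
      omega
    · simpa [hl] using this
  rcases lt_trichotomy j k with hjk | rfl | hkj
  · by_contra! hlt
    have hsum : t g k j ≤ ∑ i, t g i j :=
      Finset.single_le_sum (f := fun i => t g i j) (fun _ _ => Nat.zero_le _) (Finset.mem_univ k)
    refine hnot (hU (fun l => ?_) (ht g k j hg.1 hjk (hgk ▸ hk)))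
    have := hgu l
    by_cases hkl : k = l
    · subst hkl
      simp [hjk.ne]
    · by_cases hjl : j = l
      · subst hjl
        simp [hkl]
        omega
      · simpa [hkl, hjl] using this
  · omega
  · simp [hlast j hkj]

theorem quasiStable_of_finite_pommaret_cover {n : ℕ} {U : Set (Mon n)} (hU : IsUpperSet U)
    (H : Finset (Mon n)) (hH : ∀ u ∈ H, u ∈ U) (hcover : ∀ w ∈ U, ∃ u ∈ H, PDiv u w)
    {m : Mon n} (hm : m ∈ U) {i j : Fin n} (hji : j < i) (s : ℕ) :
    ∃ t : ℕ, m - Finsupp.single i s + Finsupp.single j t ∈ U := by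
  let T := ∑ u ∈ H, u j + 1
  obtain ⟨u, huH, a, hua, ha⟩ := hcover (m + Finsupp.single j T) (hU le_self_add hm)
  have huj : u j ≤ ∑ v ∈ H, v j :=
    Finset.single_le_sum (f := fun v : Mon n => v j) (fun _ _ => Nat.zero_le _) huH
  have hval : ∀ l, m l + Finsupp.single j T l = u l + a l := fun l => DFunLike.congr_fun hua l
  have haj : a j ≠ 0 := by
    have := hval j
    simp only [Finsupp.single_eq_same, T] at this
    omega
  refine ⟨T, hU (fun l => ?_) (hH u huH)⟩
  by_cases hil : i = l
  · subst hil
    simp [ha j haj i hji]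
  · have := hval l
    simp only [Finsupp.add_apply, Finsupp.tsub_apply, Finsupp.single_apply, hil, if_false] at *
    omega

theorem isUpperSet_monomial_mem {K : Type*} [Field K] {n : ℕ}
    (I : Ideal (MvPolynomial (Fin n) K)) :
    IsUpperSet {m : Mon n | (monomial m (1 : K) : MvPolynomial (Fin n) K) ∈ I} := by
  intro a b hab ha
  obtain ⟨c, rfl⟩ := exists_add_of_le hab
  have := I.mul_mem_right (monomial c (1 : K)) ha
  rwa [monomial_mul, one_mul] at this

/-- a nonzero monomial ideal `I ⊆ P` is quasi stable if and only if `I`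
possesses a finite Pommaret basis consisting of monomials. -/
theorem statement7 {K : Type*} [Field K] {n : ℕ}
    (I : Ideal (MvPolynomial (Fin n) K))
    (hmono : ∃ S : Set (Mon n),
      I = Ideal.span ((fun m : Mon n => (monomial m (1 : K) : MvPolynomial (Fin n) K)) '' S))
    (hne : I ≠ ⊥) :
    (∀ m : Mon n, (monomial m (1 : K) : MvPolynomial (Fin n) K) ∈ I →
      ∀ i j : Fin n, j < i → ∀ s : ℕ, 0 < s → s ≤ m i →
        ∃ t : ℕ,
          (monomial (m - Finsupp.single i s + Finsupp.single j t) (1 : K) : MvPolynomial (Fin n) K) ∈ I)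
    ↔
    (∃ H : Finset (Mon n),
      (∀ u ∈ H, (monomial u (1 : K) : MvPolynomial (Fin n) K) ∈ I) ∧
      (∀ u ∈ H, ∀ v ∈ H, u ≠ v → ¬ PDiv v u) ∧
      (∀ w : Mon n, (monomial w (1 : K) : MvPolynomial (Fin n) K) ∈ I → ∃ u ∈ H, PDiv u w)) := by
  let U : Set (Mon n) := {m | (monomial m (1 : K) : MvPolynomial (Fin n) K) ∈ I}
  have hU : IsUpperSet U := isUpperSet_monomial_mem I
  constructor
  · intro hqs
    have hfin := finite_pommaretMinimal hU hqs
    refine ⟨hfin.toFinset, fun u hu => (hfin.mem_toFinset.mp hu).1, fun u hu v hv huv h => ?_,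
      fun w hw => ?_⟩
    · exact huv ((hfin.mem_toFinset.mp hu).2 v (hfin.mem_toFinset.mp hv).1 h).symm
    · obtain ⟨u, hu, huw⟩ := exists_pommaretMinimal_pDiv (U := U) hw
      exact ⟨u, hfin.mem_toFinset.mpr hu, huw⟩
  · rintro ⟨H, hH, -, hcover⟩ m hm i j hji s - -
    exact quasiStable_of_finite_pommaret_cover hU H hH hcover hm hji s
end

section
/- Let u and v be monomials in P. If there exists a monomial w such that u Pommaret-divides w and v Pommaret-divides w, then u Pommaret-divides v or v Pommaret-divides u. -/
open MvPolynomial Finsupp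

theorem pdiv_iff {n : ℕ} {u w : Mon n} :
    PDiv u w ↔ u ≤ w ∧ ∀ i, u i < w i → PMult u i := by
  constructor
  · rintro ⟨m, rfl, hm⟩
    refine ⟨le_self_add, fun i hi => hm i fun h0 => ?_⟩
    simp [h0] at hi
  · rintro ⟨hle, hm⟩
    refine ⟨w - u, (add_tsub_cancel_of_le hle).symm, fun i hi => hm i ?_⟩
    rw [Finsupp.tsub_apply] at hi
    omega

theorem PDiv.of_le_of_le {n : ℕ} {u v w : Mon n} (hu : PDiv u w) (huv : u ≤ v)
    (hvw : v ≤ w) : PDiv u v :=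
  pdiv_iff.2 ⟨huv, fun i hi => (pdiv_iff.1 hu).2 i (hi.trans_le (hvw i))⟩

theorem PDiv.lt_index {n : ℕ} {u v w : Mon n} (hu : PDiv u w) (hvw : v ≤ w) {i k : Fin n}
    (hi : u i < v i) (hk : v k < u k) : k < i := by
  by_contra! hik
  have hne : i ≠ k := by
    rintro rfl
    exact lt_asymm hi hk
  have h0 := (pdiv_iff.1 hu).2 i (hi.trans_le (hvw i)) k (lt_of_le_of_ne hik hne)
  omega

/-- if two monomials `u`, `v` have a common Pommaret multiple `w`, then
one of them Pommaret-divides the other. -/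
theorem statement12 {n : ℕ} (u v : Mon n)
    (h : ∃ w : Mon n, PDiv u w ∧ PDiv v w) :
    PDiv u v ∨ PDiv v u := by
  obtain ⟨w, hu, hv⟩ := h
  have huw := (pdiv_iff.1 hu).1
  have hvw := (pdiv_iff.1 hv).1
  by_cases huv : u ≤ v
  · exact Or.inl (hu.of_le_of_le huv hvw)
  · refine Or.inr (hv.of_le_of_le (fun i => ?_) huw)
    obtain ⟨k, hk⟩ : ∃ k, v k < u k := by
      simpa [Finsupp.le_def] using huv
    by_contra! hi
    exact lt_asymm (hu.lt_index hvw hi hk) (hv.lt_index huw hk hi)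
end

section
/- Let H be a finite Pommaret basis of an ideal I ⊆ P w.r.t. ≺. Then H can be enumerated as h₁,…,h_t such that for every index i and every Pommaret non-multiplicative variable x_k of lm(h_i), the unique index j with lm(h_j) Pommaret-dividing x_k·lm(h_i) satisfies j > i. -/
open MvPolynomial Finsupp

/-- If `v` Pommaret-divides `xₖ · u` but not `u`, then `u` is lexicographically smaller than `v`
(with `x₁` the largest variable). -/
theorem PDiv.toLex_lt {n : ℕ} {u v : Mon n} {k : Fin n}
    (h : PDiv v (Finsupp.single k 1 + u)) (hvu : ¬ PDiv v u) : toLex u < toLex v := by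
  obtain ⟨m, hm, hmult⟩ := h
  have hcoord (i : Fin n) : Finsupp.single k 1 i + u i = v i + m i := by
    simpa using DFunLike.congr_fun hm i
  have hmk : m k = 0 := by
    by_contra hne
    refine hvu ⟨m - Finsupp.single k 1, ?_, fun i hi => hmult i fun h0 => hi (by simp [h0])⟩
    ext i
    have hi := hcoord i
    rcases eq_or_ne k i with rfl | hki
    · simp only [Finsupp.single_eq_same, Finsupp.add_apply, Finsupp.tsub_apply] at hi ⊢
      omega
    · simpa [Finsupp.single_apply, hki] using hi
  have hvk : v k = 1 + u k := by simpa [hmk] using (hcoord k).symm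
  refine Finsupp.lex_def.2 ⟨k, fun j hj => ?_, by simp [hvk]⟩
  have hmj : m j = 0 := by
    by_contra hne
    have := hmult j hne k hj
    omega
  simpa [hmj, Finsupp.single_apply, hj.ne'] using hcoord j

/-- A finite set can be listed so that an injective key function becomes strictly increasing. -/
theorem Finset.exists_enumeration_strictMono {α β : Type*} [LinearOrder β] (s : Finset α)
    (f : α → β) (hf : Set.InjOn f s) :
    ∃ e : Fin s.card → α, Set.range e = (s : Set α) ∧ StrictMono (f ∘ e) := by
  classical
  let o := (s.image f).orderEmbOfFin (Finset.card_image_of_injOn hf)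
  have ho (i : Fin s.card) : ∃ a ∈ s, f a = o i :=
    Finset.mem_image.1 (Finset.orderEmbOfFin_mem _ _ i)
  choose e he hfe using ho
  refine ⟨e, Set.Subset.antisymm (Set.range_subset_iff.2 he) fun a ha => ?_, fun i j hij => ?_⟩
  · have : f a ∈ Set.range o := by
      rw [Finset.range_orderEmbOfFin]
      exact Finset.mem_coe.2 (Finset.mem_image_of_mem f ha)
    obtain ⟨i, hi⟩ := this
    exact ⟨i, hf (he i) ha ((hfe i).trans hi)⟩
  · simpa [hfe] using hij

/-- a finite Pommaret basis `H` of an ideal `I` can be enumerated as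
`h₁, …, hₜ` so that for each `i` and each Pommaret non-multiplicative variable `xₖ`
of `lm(hᵢ)`, any index `j` with `lm(hⱼ)` Pommaret-dividing `xₖ · lm(hᵢ)` satisfies
`i < j`. -/
theorem statement15 {K : Type*} [Field K] {n : ℕ}
    (I : Ideal (MvPolynomial (Fin n) K)) (H : Finset (MvPolynomial (Fin n) K))
    (hH0 : ∀ h ∈ H, h ≠ 0) (hHI : ↑H ⊆ (I : Set (MvPolynomial (Fin n) K)))
    (hauto : ∀ f ∈ H, ∀ h ∈ H, f ≠ h → ¬ PDiv (lm h) (lm f))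
    (hdiv : ∀ f ∈ I, f ≠ 0 → ∃ h ∈ H, PDiv (lm h) (lm f)) :
    ∃ h : Fin H.card → MvPolynomial (Fin n) K, Function.Injective h ∧
      Set.range h = (H : Set (MvPolynomial (Fin n) K)) ∧
      ∀ (i : Fin H.card) (k : Fin n), ¬ PMult (lm (h i)) k →
        ∀ j : Fin H.card, PDiv (lm (h j)) (Finsupp.single k 1 + lm (h i)) → i < j := by
  have hinj : Set.InjOn (fun f : MvPolynomial (Fin n) K => toLex (lm f)) H := by
    intro f hf g hg hfg
    by_contra hne
    refine hauto f hf g hg hne ?_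
    rw [toLex.injective hfg]
    exact PDiv.refl _
  obtain ⟨h, hrange, hmono⟩ := H.exists_enumeration_strictMono _ hinj
  have hmem (i) : h i ∈ H := Finset.mem_coe.1 (hrange ▸ Set.mem_range_self i)
  refine ⟨h, hmono.injective.of_comp, hrange, fun i k hk j hj => ?_⟩
  by_cases hij : PDiv (lm (h j)) (lm (h i))
  · have heq : h i = h j := by
      by_contra hne
      exact hauto _ (hmem i) _ (hmem j) hne hij
    rw [← heq] at hj
    obtain ⟨m, hm, hmult⟩ := hj
    rw [add_comm, add_left_cancel_iff] at hm
    exact absurd (hmult k (by simp [← hm])) hk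
  · exact hmono.lt_iff_lt.1 (PDiv.toLex_lt hj hij)
end
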